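/- Let U, W be connected open subsets of ℂⁿ and let g : U → W be a proper finite surjective holomorphic map of topological degree δ with g⁻¹(0) = {0}. Let F be a singular codimension one holomorphic foliation on W defined by a holomorphic one-form ω, and suppose the pullback foliation g*F is defined on U by dx₁ (i.e., its leaves are the vertical hyperplanes {x₁ = const}). Then the pushforward (trace) function ψ(y) := Σ_{x ∈ g⁻¹(y)} x₁, where preimages are counted with multiplicity, is a holomorphic function on W satisfying dψ ∧ ω = 0 on W. -/

import Mathlib

open Set Filter Topology

noncomputable section

/-- `ℂⁿ`, modeled as the space of functions `Fin n → ℂ`. -/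
abbrev Cn (n : ℕ) : Type := Fin n → ℂ

/-- A one-form on (a subset of) `ℂⁿ`: a field of continuous `ℂ`-linear functionals. -/
abbrev OneForm (n : ℕ) : Type := Cn n → (Cn n →L[ℂ] ℂ)

/-- The exterior derivative `dω` of a one-form, evaluated at `x` on vectors `u, v`. -/
def extd {n : ℕ} (ω : OneForm n) (x u v : Cn n) : ℂ :=
  fderiv ℂ ω x u v - fderiv ℂ ω x v u

/-- The integrability condition `ω ∧ dω = 0` on `U`, written out on triples of vectors. -/
def FormIntegrableOn {n : ℕ} (ω : OneForm n) (U : Set (Cn n)) : Prop :=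
  ∀ x ∈ U, ∀ u v w : Cn n,
    ω x u * extd ω x v w + ω x v * extd ω x w u + ω x w * extd ω x u v = 0

/-- `Z` has codimension at least two: it contains no nonempty local analytic
hypersurface (the zero set of a holomorphic function, not identically zero, on a
connected open set). -/
def CodimAtLeastTwo {n : ℕ} (Z : Set (Cn n)) : Prop :=
  ¬ ∃ (q : Cn n) (V : Set (Cn n)) (ψ : Cn n → ℂ), IsOpen V ∧ IsPreconnected V ∧ q ∈ V ∧
      AnalyticOnNhd ℂ ψ V ∧ ψ q = 0 ∧ (∃ x ∈ V, ψ x ≠ 0) ∧ {x ∈ V | ψ x = 0} ⊆ Z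

/-- `ω` defines a singular codimension-one holomorphic foliation on the open set `W`:
it is holomorphic, integrable (`ω ∧ dω = 0`), and its zero set has codimension `≥ 2`.
The foliation is singular at a point `x ∈ W` iff `ω x = 0`. -/
structure IsFoliationOn {n : ℕ} (ω : OneForm n) (W : Set (Cn n)) : Prop where
  isOpen : IsOpen W
  holo : AnalyticOnNhd ℂ ω W
  integrable : FormIntegrableOn ω W
  codim : CodimAtLeastTwo {x ∈ W | ω x = 0}

open Metric in
/-- Maximum principle off the zero set of a continuous function. -/
theorem norm_le_of_forall_sphere_norm_le_off_zeros {h φ : ℂ → ℂ}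
    (hc : ContinuousOn h (closedBall 0 1))
    (hd : ∀ z ∈ ball (0 : ℂ) 1, h z ≠ 0 → DifferentiableAt ℂ h z)
    (φc : ContinuousOn φ (closedBall 0 1))
    (φd : ∀ z ∈ ball (0 : ℂ) 1, h z ≠ 0 → DifferentiableAt ℂ φ z)
    {B : ℝ} (hB : 0 < B) (φB : ∀ z ∈ sphere (0 : ℂ) 1, ‖φ z‖ ≤ B)
    {a : ℂ} (ha : a ∈ ball (0 : ℂ) 1) (hha : h a ≠ 0) : ‖φ a‖ ≤ B := by
  obtain ⟨H, hH⟩ := (isCompact_closedBall (0 : ℂ) 1).exists_bound_of_continuousOn hc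
  have hH0 : 0 ≤ H := (norm_nonneg _).trans (hH a (ball_subset_closedBall ha))
  set Ω : Set ℂ := ball 0 1 ∩ h ⁻¹' {0}ᶜ with hΩ
  have hΩo : IsOpen Ω :=
    (hc.mono ball_subset_closedBall).isOpen_inter_preimage isOpen_ball isOpen_compl_singleton
  have hΩcl : closure Ω ⊆ closedBall 0 1 :=
    closure_minimal (inter_subset_left.trans ball_subset_closedBall) isClosed_closedBall
  have key : ∀ n : ℕ, ‖φ a‖ ^ n * ‖h a‖ ≤ B ^ n * H := by
    intro n
    have hdc : DiffContOnCl ℂ (fun z => φ z ^ n * h z) Ω := by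
      refine ⟨fun z hz => ?_, ((φc.pow n).mul hc).mono hΩcl⟩
      exact (((φd z hz.1 hz.2).pow n).mul (hd z hz.1 hz.2)).differentiableWithinAt
    have := Complex.norm_le_of_forall_mem_frontier_norm_le
      (isBounded_ball.subset inter_subset_left) hdc (C := B ^ n * H) ?_
      (subset_closure (⟨ha, hha⟩ : a ∈ Ω))
    · simpa using this
    · intro z hz
      rw [hΩo.frontier_eq] at hz
      have hz1 := hΩcl hz.1
      by_cases hzs : z ∈ sphere (0 : ℂ) 1
      · simp only [norm_mul, norm_pow]
        exact mul_le_mul (pow_le_pow_left₀ (norm_nonneg _) (φB z hzs) n) (hH z hz1)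
          (norm_nonneg _) (by positivity)
      · have hzb : z ∈ ball (0 : ℂ) 1 := by
          simp only [mem_closedBall, mem_sphere, mem_ball] at *
          exact lt_of_le_of_ne hz1 hzs
        have : h z = 0 := by
          by_contra hne
          exact hz.2 ⟨hzb, hne⟩
        simp [this]; positivity
  by_contra! hlt
  have h1 : 1 < ‖φ a‖ / B := (one_lt_div hB).2 hlt
  obtain ⟨n, hn⟩ := pow_unbounded_of_one_lt (H / ‖h a‖) h1
  have hpos : 0 < ‖h a‖ := norm_pos_iff.2 hha
  rw [div_pow, div_lt_div_iff₀ hpos (by positivity)] at hn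
  have := key n
  nlinarith

open Polynomial ComplexConjugate in
/-- Density of harmonic polynomials in the continuous functions on the unit circle. -/
theorem exists_polynomial_add_conj_near {h : ℂ → ℂ} (hc : ContinuousOn h (Metric.sphere 0 1))
    {ε : ℝ} (hε : 0 < ε) :
    ∃ P Q : ℂ[X], ∀ z ∈ Metric.sphere (0 : ℂ) 1, ‖h z - (P.eval z + conj (Q.eval z))‖ ≤ ε := by
  have : Fact (0 < (1 : ℝ)) := ⟨one_pos⟩
  let H : C(AddCircle (1 : ℝ), ℂ) := ⟨fun t => h (AddCircle.toCircle t), by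
    refine hc.comp_continuous (continuous_subtype_val.comp AddCircle.continuous_toCircle) ?_
    intro t; exact (AddCircle.toCircle t).2⟩
  have hmem : H ∈ (Submodule.span ℂ (range (@fourier 1))).topologicalClosure := by
    rw [span_fourier_closure_eq_top]; trivial
  rw [← SetLike.mem_coe, Submodule.topologicalClosure_coe, Metric.mem_closure_iff] at hmem
  obtain ⟨φ, hφ, hd⟩ := hmem ε hε
  have : ∃ P Q : ℂ[X], ∀ t : AddCircle (1 : ℝ),
      φ t = P.eval (AddCircle.toCircle t : ℂ) + conj (Q.eval (AddCircle.toCircle t : ℂ)) := by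
    refine Submodule.span_induction ?_ ?_ ?_ ?_ hφ
    · rintro _ ⟨n, rfl⟩
      obtain ⟨m, rfl | rfl⟩ := n.eq_nat_or_neg
      · refine ⟨X ^ m, 0, fun t => ?_⟩
        simp [fourier_apply, AddCircle.toCircle_nsmul]
      · refine ⟨0, X ^ m, fun t => ?_⟩
        rw [fourier_neg]
        simp [fourier_apply, AddCircle.toCircle_nsmul]
    · exact ⟨0, 0, by simp⟩
    · rintro f g - - ⟨P, Q, h1⟩ ⟨P', Q', h2⟩
      refine ⟨P + P', Q + Q', fun t => ?_⟩
      simp only [ContinuousMap.add_apply, h1, h2, eval_add, map_add]; ring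
    · rintro a f - ⟨P, Q, h1⟩
      refine ⟨C a * P, C (conj a) * Q, fun t => ?_⟩
      simp only [ContinuousMap.smul_apply, h1, eval_mul, eval_C, map_mul, Complex.conj_conj,
        smul_eq_mul]; ring
  obtain ⟨P, Q, hPQ⟩ := this
  refine ⟨P, Q, fun z hz => ?_⟩
  obtain ⟨t, ht⟩ := (AddCircle.homeomorphCircle one_ne_zero).surjective
    (⟨z, hz⟩ : Circle)
  have hzt : z = (AddCircle.toCircle t : ℂ) := by
    rw [AddCircle.homeomorphCircle_apply] at ht
    rw [ht]
  have := (ContinuousMap.dist_apply_le_dist (f := H) (g := φ) t).trans hd.le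
  rw [dist_eq_norm, hPQ] at this
  rw [hzt]; exact this

open Polynomial ComplexConjugate Metric in
theorem norm_sub_polynomial_add_conj_le_off_zeros {h : ℂ → ℂ}
    (hc : ContinuousOn h (closedBall 0 1))
    (hd : ∀ z ∈ ball (0 : ℂ) 1, h z ≠ 0 → DifferentiableAt ℂ h z)
    {ε : ℝ} {P Q : ℂ[X]}
    (hPQ : ∀ z ∈ sphere (0 : ℂ) 1, ‖h z - (P.eval z + conj (Q.eval z))‖ ≤ ε)
    {a : ℂ} (ha : a ∈ ball (0 : ℂ) 1) (hha : h a ≠ 0) :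
    ‖h a - (P.eval a + conj (Q.eval a))‖ ≤ 2 * ε := by
  have main : ∀ (c s : ℂ), ‖c‖ = 1 →
      (∀ z, (c * (h z - (P.eval z + s * Q.eval z))).re =
        (c * (h z - (P.eval z + conj (Q.eval z)))).re) →
      (c * (h a - (P.eval a + conj (Q.eval a)))).re ≤ ε := by
    intro c s hcn hre
    have := norm_le_of_forall_sphere_norm_le_off_zeros hc hd
      (φ := fun z => Complex.exp (c * (h z - (P.eval z + s * Q.eval z)))) ?_ ?_
      (Real.exp_pos ε) ?_ ha hha
    · simpa only [Complex.norm_exp, Real.exp_le_exp, hre] using this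
    · refine Complex.continuous_exp.comp_continuousOn (continuousOn_const.mul (hc.sub ?_))
      fun_prop
    · intro z hz hz0
      have := hd z hz hz0
      fun_prop
    · intro z hz
      rw [Complex.norm_exp, Real.exp_le_exp, hre]
      refine (Complex.re_le_norm _).trans ?_
      rw [norm_mul, hcn, one_mul]
      exact hPQ z hz
  have e1 := main 1 1 (by simp) (by intro z; simp)
  have e2 := main (-1) 1 (by simp) (by intro z; simp)
  have e3 := main Complex.I (-1) (by simp) (by intro z; simp)
  have e4 := main (-Complex.I) (-1) (by simp) (by intro z; simp)
  refine (Complex.norm_le_abs_re_add_abs_im _).trans ?_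
  simp only [one_mul, neg_mul, Complex.neg_re, Complex.I_mul_re] at e1 e2 e3 e4
  have h1 := abs_le.2 ⟨by linarith, e1⟩
  have h2 := abs_le.2 ⟨by linarith, (by linarith : (h a - (P.eval a + conj (Q.eval a))).im ≤ ε)⟩
  linarith

/-- The Cauchy transform of a function on the unit circle. -/
def circleCauchy (u : ℂ → ℂ) (a : ℂ) : ℂ :=
  (2 * Real.pi * Complex.I : ℂ)⁻¹ • ∮ z in C(0, 1), (z - a)⁻¹ • u z

open Metric in
theorem analyticOnNhd_circleCauchy {u : ℂ → ℂ} (hu : ContinuousOn u (sphere 0 1)) :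
    AnalyticOnNhd ℂ (circleCauchy u) (ball 0 1) := by
  have hi : CircleIntegrable u 0 (1 : NNReal) := by
    refine ContinuousOn.circleIntegrable (by simp) ?_
    simpa using hu
  have := hasFPowerSeriesOn_cauchy_integral hi one_pos
  intro z hz
  have h2 := this.analyticAt_of_mem (y := z) (by rw [Metric.eball_coe]; simpa using hz)
  rw [NNReal.coe_one] at h2
  exact h2

open Metric in
theorem norm_circleCauchy_sub_le {u v : ℂ → ℂ} (hu : ContinuousOn u (sphere 0 1))
    (hv : ContinuousOn v (sphere 0 1)) {ε : ℝ} (huv : ∀ z ∈ sphere (0 : ℂ) 1, ‖u z - v z‖ ≤ ε)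
    {a : ℂ} (ha : a ∈ ball (0 : ℂ) 1) :
    ‖circleCauchy u a - circleCauchy v a‖ ≤ (1 - ‖a‖)⁻¹ * ε := by
  have ha' : ‖a‖ < 1 := by simpa using ha
  have hne : ∀ z ∈ sphere (0 : ℂ) 1, z - a ≠ 0 := by
    intro z hz h0
    rw [sub_eq_zero] at h0
    simp [← h0] at ha'
    simp [ha'.ne] at hz
  have hk : ContinuousOn (fun z : ℂ => (z - a)⁻¹) (sphere 0 1) :=
    (continuousOn_id.sub continuousOn_const).inv₀ hne
  have h1 : CircleIntegrable (fun z => (z - a)⁻¹ • u z) 0 1 :=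
    (hk.smul hu).circleIntegrable zero_le_one
  have h2 : CircleIntegrable (fun z => (z - a)⁻¹ • v z) 0 1 :=
    (hk.smul hv).circleIntegrable zero_le_one
  rw [circleCauchy, circleCauchy, ← smul_sub, ← circleIntegral.integral_sub h1 h2]
  refine (circleIntegral.norm_two_pi_i_inv_smul_integral_le_of_norm_le_const zero_le_one
    (C := (1 - ‖a‖)⁻¹ * ε) ?_).trans (by simp)
  intro z hz
  rw [← smul_sub, norm_smul, norm_inv]
  have hz1 : ‖z‖ = 1 := by simpa using hz
  have : 1 - ‖a‖ ≤ ‖z - a‖ := by rw [← hz1]; exact norm_sub_norm_le z a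
  have hpos : 0 < 1 - ‖a‖ := by linarith
  gcongr
  exact huv z hz

open Metric ComplexConjugate in
theorem circleCauchy_add_conj {p q : ℂ → ℂ} (hp : Differentiable ℂ p) (hq : Differentiable ℂ q)
    {a : ℂ} (ha : a ∈ ball (0 : ℂ) 1) :
    circleCauchy (fun z => p z + conj (q z)) a = p a + conj (q 0) := by
  have ha' : ‖a‖ < 1 := by simpa using ha
  have hne : ∀ z ∈ sphere (0 : ℂ) 1, z - a ≠ 0 := by
    intro z hz h0
    rw [sub_eq_zero] at h0
    simp [← h0] at ha'
    simp [ha'.ne] at hz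
  have hk : ContinuousOn (fun z : ℂ => (z - a)⁻¹) (sphere 0 1) :=
    (continuousOn_id.sub continuousOn_const).inv₀ hne
  have hqc : Continuous fun z => conj (q z) := Complex.continuous_conj.comp hq.continuous
  have h1 : CircleIntegrable (fun z => (z - a)⁻¹ • p z) 0 1 :=
    (hk.smul hp.continuous.continuousOn).circleIntegrable zero_le_one
  have h2 : CircleIntegrable (fun z => (z - a)⁻¹ • conj (q z)) 0 1 :=
    (hk.smul hqc.continuousOn).circleIntegrable zero_le_one
  have e1 : (2 * Real.pi * Complex.I : ℂ)⁻¹ • ∮ z in C(0, 1), (z - a)⁻¹ • p z = p a :=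
    hp.diffContOnCl.two_pi_i_inv_smul_circleIntegral_sub_inv_smul ha
  have hden : ∀ z ∈ closedBall (0 : ℂ) 1, 1 - conj a * z ≠ 0 := by
    intro z hz h0
    rw [sub_eq_zero] at h0
    have h3 : ‖conj a * z‖ = 1 := by rw [← h0]; simp
    have hz1 : ‖z‖ ≤ 1 := by simpa using hz
    rw [norm_mul, RCLike.norm_conj] at h3
    nlinarith [norm_nonneg a, norm_nonneg z]
  have hdc : DiffContOnCl ℂ (fun z => q z / (1 - conj a * z)) (ball 0 |1|) := by
    have : DifferentiableOn ℂ (fun z => q z / (1 - conj a * z)) (closedBall 0 1) :=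
      hq.differentiableOn.fun_div (by fun_prop) hden
    rw [abs_one]
    exact this.diffContOnCl_ball subset_rfl
  have e2 : (2 * Real.pi * Complex.I : ℂ)⁻¹ • ∮ z in C(0, 1), (z - a)⁻¹ • conj (q z)
      = conj (q 0) := by
    have e3 := hdc.circleAverage
    have hci : CircleIntegrable (fun z => q z / (1 - conj a * z)) 0 1 := by
      refine ContinuousOn.circleIntegrable zero_le_one ?_
      exact hq.continuous.continuousOn.div (by fun_prop)
        (fun z hz => hden z (sphere_subset_closedBall hz))
    have e4 := (Complex.conjCLE : ℂ →L[ℝ] ℂ).circleAverage_comp_comm hci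
    rw [e3] at e4
    have e5 : (Complex.conjCLE : ℂ →L[ℝ] ℂ) (q 0 / (1 - conj a * 0)) = conj (q 0) := by simp
    rw [e5] at e4
    rw [← e4, Real.circleAverage_eq_circleIntegral one_ne_zero]
    congr 1
    refine circleIntegral.integral_congr zero_le_one fun z hz => ?_
    have hz1 : z * conj z = 1 := by
      rw [Complex.mul_conj, Complex.normSq_eq_norm_sq]
      have : ‖z‖ = 1 := by simpa using hz
      simp [this]
    have hz0 : z ≠ 0 := by rintro rfl; simp at hz1
    have : z - a = z * (1 - a * conj z) := by linear_combination a * hz1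
    have h6 := hne z hz
    have h7 : 1 - a * conj z ≠ 0 := by
      intro h; rw [this, h] at h6; simp at h6
    simp only [smul_eq_mul, Function.comp_apply, sub_zero, this]
    simp
    field_simp
  rw [circleCauchy, ← e1, ← e2, ← smul_add, ← circleIntegral.integral_add h1 h2]
  simp [mul_add]

open Metric ComplexConjugate Polynomial in
/-- A function continuous on the closed unit disc and holomorphic off its zeros is there the sum of
a holomorphic and an antiholomorphic function. -/
theorem eq_circleCauchy_add_conj_off_zeros {h : ℂ → ℂ}
    (hc : ContinuousOn h (closedBall 0 1))
    (hd : ∀ z ∈ ball (0 : ℂ) 1, h z ≠ 0 → DifferentiableAt ℂ h z)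
    {a : ℂ} (ha : a ∈ ball (0 : ℂ) 1) (hha : h a ≠ 0) :
    h a = circleCauchy h a - circleCauchy h 0 + conj (circleCauchy (fun z => conj (h z)) a) := by
  have ha' : ‖a‖ < 1 := by simpa using ha
  have hpos : 0 < (1 - ‖a‖)⁻¹ := by
    have : 0 < 1 - ‖a‖ := by linarith
    positivity
  rw [← sub_eq_zero, ← norm_le_zero_iff]
  set K := (1 - ‖a‖)⁻¹
  refine le_of_forall_pos_le_add fun η hη => ?_
  obtain ⟨ε, hε, hεη⟩ : ∃ ε > 0, (2 * K + 3) * ε ≤ η :=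
    ⟨η / (2 * K + 3), by positivity, by field_simp; rfl⟩
  have hcs := hc.mono sphere_subset_closedBall
  obtain ⟨P, Q, hPQ⟩ := exists_polynomial_add_conj_near hcs hε
  have b1 := norm_sub_polynomial_add_conj_le_off_zeros hc hd hPQ ha hha
  have cP : Continuous fun z => conj (P.eval z) := Complex.continuous_conj.comp P.continuous
  have cQ : Continuous fun z => conj (Q.eval z) := Complex.continuous_conj.comp Q.continuous
  have b2 := norm_circleCauchy_sub_le (v := fun z => P.eval z + conj (Q.eval z)) hcs (P.continuous.add cQ).continuousOn hPQ ha
  have b3 := norm_circleCauchy_sub_le (v := fun z => P.eval z + conj (Q.eval z)) hcs (P.continuous.add cQ).continuousOn hPQ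
    (mem_ball_self one_pos)
  have b4 := norm_circleCauchy_sub_le (u := fun z => conj (h z))
    (v := fun z => Q.eval z + conj (P.eval z))
    (Complex.continuous_conj.comp_continuousOn hcs)
    (Q.continuous.add cP).continuousOn (ε := ε) (by
      intro z hz
      rw [← RCLike.norm_conj]
      convert! hPQ z hz using 2
      simp [add_comm]) ha
  rw [circleCauchy_add_conj P.differentiable Q.differentiable ha] at b2
  rw [circleCauchy_add_conj P.differentiable Q.differentiable (mem_ball_self one_pos)] at b3
  rw [circleCauchy_add_conj Q.differentiable P.differentiable ha, ← RCLike.norm_conj] at b4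
  simp only [norm_zero, sub_zero, inv_one, one_mul] at b3
  have : h a - (circleCauchy h a - circleCauchy h 0 + conj (circleCauchy (fun z => conj (h z)) a))
      = (h a - (P.eval a + conj (Q.eval a)))
        - (circleCauchy h a - (P.eval a + conj (Q.eval 0)))
        + (circleCauchy h 0 - (P.eval 0 + conj (Q.eval 0)))
        - conj (circleCauchy (fun z => conj (h z)) a - (Q.eval a + conj (P.eval 0))) := by
    simp only [map_sub, map_add, Complex.conj_conj]; ring
  rw [this, zero_add]
  refine (norm_sub_le _ _).trans ?_
  refine (add_le_add_left (norm_add_le _ _) _).trans ?_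
  have := norm_sub_le (h a - (P.eval a + conj (Q.eval a)))
    (circleCauchy h a - (P.eval a + conj (Q.eval 0)))
  linarith

open Metric ComplexConjugate in
/-- **Radó's theorem** on the unit disc. -/
theorem differentiableOn_ball_of_differentiableAt_off_zeros {h : ℂ → ℂ}
    (hc : ContinuousOn h (closedBall 0 1))
    (hd : ∀ z ∈ ball (0 : ℂ) 1, h z ≠ 0 → DifferentiableAt ℂ h z) :
    DifferentiableOn ℂ h (ball 0 1) := by
  set Ω : Set ℂ := ball 0 1 ∩ h ⁻¹' {0}ᶜ with hΩ
  have hΩo : IsOpen Ω :=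
    (hc.mono ball_subset_closedBall).isOpen_inter_preimage isOpen_ball isOpen_compl_singleton
  have hcs := hc.mono sphere_subset_closedBall
  set G := circleCauchy (fun z => conj (h z)) with hG
  have hGa : AnalyticOnNhd ℂ G (ball 0 1) :=
    analyticOnNhd_circleCauchy (Complex.continuous_conj.comp_continuousOn hcs)
  have hHa : AnalyticOnNhd ℂ (circleCauchy h) (ball 0 1) := analyticOnNhd_circleCauchy hcs
  have heq : ∀ z ∈ Ω, h z = circleCauchy h z - circleCauchy h 0 + conj (G z) :=
    fun z hz => eq_circleCauchy_add_conj_off_zeros hc hd hz.1 hz.2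
  rcases Ω.eq_empty_or_nonempty with hem | ⟨z₀, hz₀⟩
  · refine (differentiableOn_const (0 : ℂ)).congr fun z hz => ?_
    by_contra hne
    exact (hem ▸ (⟨hz, hne⟩ : z ∈ Ω) : z ∈ (∅ : Set ℂ))
  have hG' : ∀ z ∈ Ω, deriv G z = 0 := by
    intro z hz
    have d1 : DifferentiableAt ℂ (fun w => conj (G w)) z := by
      have : DifferentiableAt ℂ (fun w => h w - (circleCauchy h w - circleCauchy h 0)) z :=
        (hd z hz.1 hz.2).sub ((hHa z hz.1).differentiableAt.sub_const _)
      refine this.congr_of_eventuallyEq ?_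
      filter_upwards [hΩo.mem_nhds hz] with w hw
      rw [heq w hw]; ring
    have d2 := (hGa z hz.1).differentiableAt
    have r1 := (d1.hasDerivAt.hasFDerivAt).restrictScalars ℝ
    have r2 := (Complex.conjCLE : ℂ →L[ℝ] ℂ).hasFDerivAt.comp z
      ((d2.hasDerivAt.hasFDerivAt).restrictScalars ℝ)
    have r3 := r1.unique r2
    have v1 := congrArg (fun L : ℂ →L[ℝ] ℂ => L 1) r3
    have v2 := congrArg (fun L : ℂ →L[ℝ] ℂ => L Complex.I) r3
    simp at v1 v2
    rw [v1] at v2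
    have : conj (deriv G z) = 0 := by
      have h2 : Complex.I * conj (deriv G z) = 0 := by linear_combination v2 / 2
      simpa using h2
    simpa using this
  have hGc : ∀ z ∈ ball (0 : ℂ) 1, G z = G z₀ := by
    have hd0 : EqOn (deriv G) 0 (ball 0 1) := by
      refine hGa.deriv.eqOn_zero_of_preconnected_of_eventuallyEq_zero
        (convex_ball 0 1).isPreconnected hz₀.1 ?_
      filter_upwards [hΩo.mem_nhds hz₀] with w hw using hG' w hw
    intro z hz
    exact isOpen_ball.is_const_of_deriv_eq_zero (convex_ball 0 1).isPreconnected
      hGa.differentiableOn hd0 hz hz₀.1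
  set F : ℂ → ℂ := fun z => circleCauchy h z - circleCauchy h 0 + conj (G z₀) with hF
  have hFa : AnalyticOnNhd ℂ F (ball 0 1) := fun z hz =>
    ((hHa z hz).sub analyticAt_const).add analyticAt_const
  have hFeq : ∀ z ∈ Ω, h z = F z := fun z hz => by rw [heq z hz, hGc z hz.1]
  have hcat : ∀ z ∈ ball (0 : ℂ) 1, ContinuousAt h z := fun z hz =>
    hc.continuousAt (closedBall_mem_nhds_of_mem hz)
  have hout : ∀ z ∈ ball (0 : ℂ) 1, z ∉ closure Ω → DifferentiableAt ℂ h z := by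
    intro z hz hzc
    refine (differentiableAt_const (0 : ℂ)).congr_of_eventuallyEq ?_
    filter_upwards [isClosed_closure.isOpen_compl.mem_nhds hzc, isOpen_ball.mem_nhds hz]
      with w hw hwb
    by_contra hne
    exact hw (subset_closure ⟨hwb, hne⟩)
  have hcl : ∀ z ∈ ball (0 : ℂ) 1, z ∈ closure Ω → h z = F z := by
    intro z hz hzc
    have : (𝓝[Ω] z).NeBot := mem_closure_iff_nhdsWithin_neBot.1 hzc
    refine tendsto_nhds_unique (l := 𝓝[Ω] z) ((hcat z hz).mono_left nhdsWithin_le_nhds)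
      (((hFa z hz).continuousAt.tendsto.mono_left nhdsWithin_le_nhds).congr' ?_)
    filter_upwards [self_mem_nhdsWithin] with w hw using (hFeq w hw).symm
  intro z hz
  refine DifferentiableAt.differentiableWithinAt ?_
  by_cases hzΩ : z ∈ Ω
  · exact hd z hz hzΩ.2
  by_cases hzc : z ∈ closure Ω
  swap
  · exact hout z hz hzc
  refine (Complex.analyticAt_of_differentiable_on_punctured_nhds_of_continuousAt ?_
    (hcat z hz)).differentiableAt
  have hnz : ∀ᶠ w in 𝓝[≠] z, F w ≠ 0 := by
    rcases (hFa z hz).eventually_eq_zero_or_eventually_ne_zero with h0 | h0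
    · exact absurd ((hFeq z₀ hz₀).trans (hFa.eqOn_zero_of_preconnected_of_eventuallyEq_zero
        (convex_ball 0 1).isPreconnected hz h0 hz₀.1)) hz₀.2
    · exact h0
  filter_upwards [hnz, nhdsWithin_le_nhds (isOpen_ball.mem_nhds hz)] with w hw hwb
  by_cases hwc : w ∈ closure Ω
  · exact hd w hwb (by rw [hcl w hwb hwc]; exact hw)
  · exact hout w hwb hwc

open Metric MeasureTheory Real in
theorem continuous_torusMap {n : ℕ} (c : Fin n → ℂ) (R : Fin n → ℝ) :
    Continuous (torusMap c R) := by
  unfold torusMap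
  fun_prop

theorem torusMap_apply_sub_ne_zero {n : ℕ} {c y : Fin n → ℂ} {r : ℝ} (hy : y ∈ Metric.ball c r)
    (θ : Fin n → ℝ) (i : Fin n) : torusMap c (fun _ => r) θ i - y i ≠ 0 := by
  intro h
  have hr : 0 < r := Metric.pos_of_mem_ball hy
  have h1 : dist (y i) (c i) < r := (dist_le_pi_dist y c i).trans_lt hy
  rw [← sub_eq_zero.1 h] at h1
  simp [torusMap, dist_eq_norm, Complex.norm_exp_ofReal_mul_I, abs_of_pos hr] at h1

theorem torusMap_mem_closedBall {n : ℕ} (c : Fin n → ℂ) {r : ℝ} (hr : 0 ≤ r) (θ : Fin n → ℝ) :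
    torusMap c (fun _ => r) θ ∈ Metric.closedBall c r := by
  rw [Metric.mem_closedBall, dist_pi_le_iff hr]
  intro i
  simp [torusMap, dist_eq_norm, Complex.norm_exp_ofReal_mul_I, abs_of_nonneg hr]

open Metric MeasureTheory in
theorem torusIntegrable_of_continuousOn {n : ℕ} {f : (Fin n → ℂ) → ℂ} {c : Fin n → ℂ} {r : ℝ}
    (hf : Continuous fun θ => f (torusMap c (fun _ => r) θ)) :
    TorusIntegrable f c (fun _ => r) :=
  hf.continuousOn.integrableOn_compact isCompact_Icc

open Metric in
/-- The Cauchy formula on a polydisc. -/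
theorem two_pi_I_inv_pow_smul_torusIntegral {n : ℕ} {f : (Fin n → ℂ) → ℂ} {c y : Fin n → ℂ}
    {r ρ : ℝ} (hρ : r < ρ) (hf : DifferentiableOn ℂ f (ball c ρ)) (hy : y ∈ ball c r) :
    (2 * Real.pi * Complex.I : ℂ)⁻¹ ^ n •
      (∯ x in T(c, fun _ => r), (∏ i, (x i - y i)⁻¹) • f x) = f y := by
  have hr : 0 < r := pos_of_mem_ball hy
  induction n with
  | zero => simp [Subsingleton.elim c y]
  | succ n ih =>
    have hy0 : y 0 ∈ ball (c 0) r := (dist_le_pi_dist y c 0).trans_lt hy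
    have hyt : Fin.tail y ∈ ball (Fin.tail c) r := by
      rw [mem_ball, dist_pi_lt_iff hr]
      exact fun i => (dist_le_pi_dist y c i.succ).trans_lt hy
    have hcons : ∀ x ∈ ball (c 0) ρ, ∀ z ∈ ball (Fin.tail c) ρ,
        (Fin.cons x z : Fin (n + 1) → ℂ) ∈ ball c ρ := by
      intro x hx z hz
      rw [mem_ball, dist_pi_lt_iff (hr.trans hρ)]
      refine Fin.cases ?_ fun i => ?_
      · simpa using hx
      · simpa [Fin.tail] using (dist_le_pi_dist z (Fin.tail c) i).trans_lt hz
    have hint : TorusIntegrable (fun x => (∏ i, (x i - y i)⁻¹) • f x) c (fun _ => r) := by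
      refine torusIntegrable_of_continuousOn ?_
      refine Continuous.mul (M := ℂ) ?_ ?_
      · refine continuous_finsetProd _ fun i _ => Continuous.inv₀ ?_
          fun θ => torusMap_apply_sub_ne_zero hy θ i
        exact (continuous_pi_iff.1 (continuous_torusMap c fun _ => r) i).sub continuous_const
      · exact hf.continuousOn.comp_continuous (continuous_torusMap _ _) fun θ =>
          closedBall_subset_ball hρ (torusMap_mem_closedBall c hr.le θ)
    rw [torusIntegral_succ hint]
    have h1 : ∀ x ∈ sphere (c 0) r,
        (∯ z in T(c ∘ Fin.succ, (fun _ => r) ∘ Fin.succ),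
          (∏ i, ((Fin.cons x z : Fin (n + 1) → ℂ) i - y i)⁻¹) • f (Fin.cons x z)) =
        (x - y 0)⁻¹ • ((2 * Real.pi * Complex.I : ℂ) ^ n • f (Fin.cons x (Fin.tail y))) := by
      intro x hx
      have hx' : x ∈ ball (c 0) ρ := sphere_subset_closedBall.trans (closedBall_subset_ball hρ) hx
      have hfx : DifferentiableOn ℂ (fun z : Fin n → ℂ => f (Fin.cons x z))
          (ball (Fin.tail c) ρ) := by
        refine hf.comp (f := fun z : Fin n → ℂ => (Fin.cons x z : Fin (n + 1) → ℂ)) ?_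
          fun z hz => hcons x hx' z hz
        refine Differentiable.differentiableOn (differentiable_pi.2 (Fin.cases ?_ fun i => ?_))
        · simp
        · simp only [Fin.cons_succ]; fun_prop
      have := ih hfx hyt
      rw [← this, smul_smul (_ ^ n), ← mul_pow, mul_inv_cancel₀ Complex.two_pi_I_ne_zero, one_pow,
        one_smul, ← torusIntegral_smul]
      simp only [Fin.prod_univ_succ, Fin.cons_zero, Fin.cons_succ, smul_smul]
      rfl
    rw [circleIntegral.integral_congr hr.le h1]
    have hf0 : DiffContOnCl ℂ (fun x => (2 * Real.pi * Complex.I : ℂ) ^ n •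
        f (Fin.cons x (Fin.tail y))) (ball (c 0) r) := by
      refine DifferentiableOn.diffContOnCl_ball (U := ball (c 0) ρ) ?_ (closedBall_subset_ball hρ)
      refine DifferentiableOn.fun_const_smul ?_ _
      refine hf.comp (f := fun x : ℂ => (Fin.cons x (Fin.tail y) : Fin (n + 1) → ℂ)) ?_
          fun x hx => hcons x hx _ (ball_subset_ball hρ.le hyt)
      refine Differentiable.differentiableOn (differentiable_pi.2 (Fin.cases ?_ fun i => ?_))
      · simp only [Fin.cons_zero]; fun_prop
      · simp
    have := hf0.two_pi_i_inv_smul_circleIntegral_sub_inv_smul hy0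
    rw [pow_succ, mul_smul, this, smul_smul, ← mul_pow, inv_mul_cancel₀ Complex.two_pi_I_ne_zero,
      one_pow, one_smul, Fin.cons_self_tail]

open MeasureTheory in
theorem exists_continuousLinearMap_eq_integral_mul {X : Type*} [TopologicalSpace X]
    [CompactSpace X] [MeasurableSpace X] [BorelSpace X] (μ : Measure X) [IsFiniteMeasure μ]
    (w : C(X, ℂ)) : ∃ L : C(X, ℂ) →L[ℂ] ℂ, ∀ φ, L φ = ∫ x, w x * φ x ∂μ := by
  have hint : ∀ φ : C(X, ℂ), Integrable (fun x => w x * φ x) μ := fun φ => by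
    refine Integrable.of_bound (C := ‖w * φ‖) ?_ (Eventually.of_forall fun x => ?_)
    · exact (w * φ).continuous.aestronglyMeasurable_of_compactSpace
    · exact (w * φ).norm_coe_le_norm x
  refine ⟨LinearMap.mkContinuous ⟨⟨fun φ => ∫ x, w x * φ x ∂μ, fun φ χ => ?_⟩, fun a φ => ?_⟩
    (‖w‖ * μ.real univ) fun φ => ?_, fun φ => rfl⟩
  · simp only [ContinuousMap.add_apply, mul_add]
    exact integral_add (hint φ) (hint χ)
  · simp only [ContinuousMap.smul_apply, smul_eq_mul, RingHom.id_apply, mul_left_comm _ a]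
    exact integral_const_mul a _
  · refine (norm_integral_le_of_norm_le_const (C := ‖w‖ * ‖φ‖) (Eventually.of_forall fun x => ?_)
      ).trans (by linarith)
    rw [norm_mul]
    gcongr
    · exact w.norm_coe_le_norm x
    · exact φ.norm_coe_le_norm x

open Metric MeasureTheory in
/-- **Osgood's lemma**: complex differentiable functions of several variables are analytic. -/
theorem DifferentiableOn.analyticOnNhd_pi {n : ℕ} {f : (Fin n → ℂ) → ℂ} {V : Set (Fin n → ℂ)}
    (hf : DifferentiableOn ℂ f V) (hV : IsOpen V) : AnalyticOnNhd ℂ f V := by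
  intro c hc
  obtain ⟨ρ, hρ0, hρ⟩ := Metric.isOpen_iff.1 hV c hc
  have hf' := hf.mono hρ
  set r := ρ / 2 with hr
  have hrρ : r < ρ := by linarith
  have hr0 : 0 < r := by linarith
  set K := Icc (0 : Fin n → ℝ) fun _ => 2 * Real.pi with hK
  have hm : MeasurableSet K := measurableSet_Icc
  let e : Fin n → C(K, ℂ) := fun i => ⟨fun θ => torusMap c (fun _ => r) θ i, by
    exact (continuous_apply i).comp
      ((continuous_torusMap c fun _ => r).comp continuous_subtype_val)⟩
  let w : C(K, ℂ) := ⟨fun θ => (∏ i, (r : ℂ) * Complex.exp (θ.1 i * Complex.I) * Complex.I) *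
      f (torusMap c (fun _ => r) θ), by
    refine Continuous.mul (continuous_finsetProd _ fun i _ => ?_) ?_
    · have : Continuous fun θ : K => θ.1 i := (continuous_apply i).comp continuous_subtype_val
      exact (continuous_const.mul (Complex.continuous_exp.comp
        ((Complex.continuous_ofReal.comp this).mul continuous_const))).mul continuous_const
    exact hf'.continuousOn.comp_continuous
      ((continuous_torusMap _ _).comp continuous_subtype_val) fun θ =>
          closedBall_subset_ball hrρ (torusMap_mem_closedBall c hr0.le θ)⟩
  let Φ : (Fin n → ℂ) → C(K, ℂ) := fun y => ∏ i, Ring.inverse (e i - algebraMap ℂ C(K, ℂ) (y i))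
  have hunit : ∀ y ∈ ball c r, ∀ i, IsUnit (e i - algebraMap ℂ C(K, ℂ) (y i)) := by
    intro y hy i
    rw [ContinuousMap.isUnit_iff_forall_ne_zero]
    intro θ
    exact torusMap_apply_sub_ne_zero hy θ i
  have hΦ : AnalyticAt ℂ Φ c := by
    refine Finset.analyticAt_fun_prod _ fun i _ => ?_
    obtain ⟨u, hu⟩ := hunit c (mem_ball_self hr0) i
    refine AnalyticAt.comp (g := Ring.inverse)
      (f := fun y : Fin n → ℂ => e i - algebraMap ℂ C(K, ℂ) (y i)) ?_ ?_
    · rw [← hu]; exact analyticAt_inverse u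
    · refine analyticAt_const.sub ?_
      exact ((Algebra.linearMap ℂ C(K, ℂ)).mkContinuous ‖(1 : C(K, ℂ))‖ (fun x => by
        simp [Algebra.algebraMap_eq_smul_one, norm_smul, mul_comm])).analyticAt _ |>.comp
          ((ContinuousLinearMap.proj i : (Fin n → ℂ) →L[ℂ] ℂ).analyticAt c)
  have : IsFiniteMeasure ((volume : Measure (Fin n → ℝ)).comap (Subtype.val : K → _)) := by
    refine ⟨?_⟩
    rw [comap_subtype_coe_apply hm]
    simpa using isCompact_Icc.measure_lt_top
  obtain ⟨L, hL⟩ := exists_continuousLinearMap_eq_integral_mul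
    ((volume : Measure (Fin n → ℝ)).comap (Subtype.val : K → _)) w
  have hfin := ((L.analyticAt (Φ c)).comp hΦ).const_smul
    (c := (2 * Real.pi * Complex.I : ℂ)⁻¹ ^ n)
  refine hfin.congr ?_
  filter_upwards [ball_mem_nhds c hr0] with y hy
  rw [← two_pi_I_inv_pow_smul_torusIntegral hrρ hf' hy]
  simp only [Pi.smul_apply, Function.comp_apply]
  congr 1
  rw [hL, torusIntegral, ← integral_subtype_comap hm]
  refine integral_congr_ae (Eventually.of_forall fun θ => ?_)
  simp only [w, Φ, ContinuousMap.coe_mk, smul_eq_mul, ContinuousMap.prod_apply]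
  have : ∀ i, (Ring.inverse (e i - algebraMap ℂ C(K, ℂ) (y i))) θ =
      (torusMap c (fun _ => r) θ i - y i)⁻¹ := by
    intro i
    obtain ⟨u, hu⟩ := hunit y hy i
    refine eq_inv_of_mul_eq_one_left ?_
    have h2 := congrArg (fun F : C(K, ℂ) => F θ) (Ring.inverse_mul_cancel _ (hunit y hy i))
    exact h2
  simp only [this]
  ring

open Metric MeasureTheory in
theorem differentiableOn_circleAverage_add_smul {n : ℕ} {φ : (Fin n → ℂ) → ℂ}
    {A : Set (Fin n → ℂ)} (hφ : AnalyticOnNhd ℂ φ A) {y₀ e : Fin n → ℂ} {r η : ℝ} (hr : 0 ≤ r)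
    (hA : ∀ y ∈ closedBall y₀ η, ∀ t ∈ sphere (0 : ℂ) r, y + t • e ∈ A) :
    DifferentiableOn ℂ (fun y => Real.circleAverage (fun t => φ (y + t • e)) 0 r) (ball y₀ η) := by
  intro y₁ hy₁
  refine DifferentiableAt.differentiableWithinAt ?_
  have hcm : ∀ θ, circleMap 0 r θ ∈ sphere (0 : ℂ) r := fun θ => circleMap_mem_sphere 0 hr θ
  obtain ⟨C, hC⟩ := ((isCompact_closedBall y₀ η).prod (isCompact_sphere (0 : ℂ) r)
    ).exists_bound_of_continuousOn (f := fun p : (Fin n → ℂ) × ℂ => fderiv ℂ φ (p.1 + p.2 • e)) (by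
      refine hφ.fderiv.continuousOn.comp (by fun_prop) ?_
      exact fun p hp => hA p.1 hp.1 p.2 hp.2)
  have hcont : ∀ y ∈ closedBall y₀ η, Continuous fun θ => φ (y + circleMap 0 r θ • e) := by
    intro y hy
    exact hφ.continuousOn.comp_continuous (by fun_prop) fun θ => hA y hy _ (hcm θ)
  have hsub : ball y₀ η ⊆ closedBall y₀ η := ball_subset_closedBall
  have key := intervalIntegral.hasFDerivAt_integral_of_dominated_of_fderiv_le (𝕜 := ℂ)
    (μ := volume) (a := 0) (b := 2 * Real.pi) (s := ball y₀ η) (x₀ := y₁) (bound := fun _ => C)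
    (F := fun y θ => φ (y + circleMap 0 r θ • e))
    (F' := fun y θ => fderiv ℂ φ (y + circleMap 0 r θ • e))
    (isOpen_ball.mem_nhds hy₁) ?_ ?_ ?_ ?_ ?_ ?_
  · simp only [Real.circleAverage]
    exact key.differentiableAt.const_smul ((2 * Real.pi)⁻¹ : ℝ)
  · filter_upwards [isOpen_ball.mem_nhds hy₁] with y hy
    exact (hcont y (hsub hy)).aestronglyMeasurable
  · exact (hcont y₁ (hsub hy₁)).intervalIntegrable _ _
  · refine Continuous.aestronglyMeasurable ?_
    exact hφ.fderiv.continuousOn.comp_continuous (by fun_prop) fun θ => hA _ (hsub hy₁) _ (hcm θ)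
  · exact Eventually.of_forall fun θ _ y hy => hC (y, circleMap 0 r θ) ⟨hsub hy, hcm θ⟩
  · exact intervalIntegrable_const
  · refine Eventually.of_forall fun θ _ y hy => ?_
    have := (hφ _ (hA y (hsub hy) _ (hcm θ))).differentiableAt.hasFDerivAt
    have h2 := this.comp y ((hasFDerivAt_id y).add_const (circleMap 0 r θ • e))
    rw [ContinuousLinearMap.comp_id] at h2
    exact h2

open Metric in
/-- The mean value property for a bounded function that is holomorphic off the zeros of a
continuous function, itself holomorphic off its zeros. -/
theorem circleAverage_eq_of_bounded_off_zeros {k u : ℂ → ℂ} {M r : ℝ}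
    (hk : ContinuousOn k (closedBall 0 1))
    (hkd : ∀ t ∈ ball (0 : ℂ) 1, k t ≠ 0 → DifferentiableAt ℂ k t)
    (hud : ∀ t ∈ ball (0 : ℂ) 1, k t ≠ 0 → DifferentiableAt ℂ u t)
    (hub : ∀ t ∈ ball (0 : ℂ) 1, k t ≠ 0 → ‖u t‖ ≤ M)
    (hk0 : k 0 ≠ 0) (hr : 0 < r) (hr1 : r < 1) (hkr : ∀ t ∈ sphere (0 : ℂ) r, k t ≠ 0) :
    Real.circleAverage u 0 r = u 0 := by
  have hka : AnalyticOnNhd ℂ k (ball 0 1) :=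
    (differentiableOn_ball_of_differentiableAt_off_zeros hk hkd).analyticOnNhd isOpen_ball
  have h0 : (0 : ℂ) ∈ ball (0 : ℂ) 1 := mem_ball_self one_pos
  have hiso : ∀ t ∈ ball (0 : ℂ) 1, ∀ᶠ s in 𝓝[≠] t, k s ≠ 0 ∧ s ∈ ball (0 : ℂ) 1 := by
    intro t ht
    refine Eventually.and ?_ (nhdsWithin_le_nhds (isOpen_ball.mem_nhds ht))
    rcases (hka t ht).eventually_eq_zero_or_eventually_ne_zero with h | h
    · exact absurd (hka.eqOn_zero_of_preconnected_of_eventuallyEq_zero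
        (convex_ball 0 1).isPreconnected ht h h0) hk0
    · exact h
  set v : ℂ → ℂ := fun t => limUnder (𝓝[≠] t) u with hv
  have hlim : ∀ t ∈ ball (0 : ℂ) 1, Tendsto u (𝓝[≠] t) (𝓝 (v t)) := by
    intro t ht
    refine Complex.tendsto_limUnder_of_differentiable_on_punctured_nhds_of_bounded_under ?_ ?_
    · filter_upwards [hiso t ht] with s hs using hud s hs.2 hs.1
    · refine ⟨M + ‖u t‖, eventually_map.2 ?_⟩
      filter_upwards [hiso t ht] with s hs
      exact (norm_sub_le _ _).trans (by gcongr; exact hub s hs.2 hs.1)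
  have hvu : ∀ t ∈ ball (0 : ℂ) 1, k t ≠ 0 → v t = u t := fun t ht hkt =>
    tendsto_nhds_unique (hlim t ht) (hud t ht hkt).continuousAt.continuousWithinAt
  have hvd : DifferentiableOn ℂ v (ball 0 1) := by
    intro t ht
    refine DifferentiableAt.differentiableWithinAt ?_
    refine (Complex.analyticAt_of_differentiable_on_punctured_nhds_of_continuousAt ?_ ?_
      ).differentiableAt
    · filter_upwards [eventually_eventually_nhdsWithin.2 (hiso t ht), self_mem_nhdsWithin,
        hiso t ht] with s hs hst hs'
      refine (hud s hs'.2 hs'.1).congr_of_eventuallyEq ?_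
      rw [(isOpen_compl_singleton (x := t)).nhdsWithin_eq hst] at hs
      filter_upwards [hs] with w hw using hvu w hw.2 hw.1
    · rw [continuousAt_iff_punctured_nhds]
      refine (hlim t ht).congr' ?_
      filter_upwards [hiso t ht] with s hs using (hvu s hs.2 hs.1).symm
  have hdc : DiffContOnCl ℂ v (ball 0 |r|) := by
    rw [abs_of_pos hr]
    exact hvd.diffContOnCl_ball (closedBall_subset_ball hr1)
  rw [← hvu 0 h0 hk0, ← hdc.circleAverage]
  refine Real.circleAverage_congr_sphere fun t ht => ?_
  rw [abs_of_pos hr] at ht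
  exact (hvu t (sphere_subset_closedBall.trans (closedBall_subset_ball hr1) ht) (hkr t ht)).symm

open Metric in
theorem exists_analyticAt_eq_off_zeros {n : ℕ} {W : Set (Fin n → ℂ)} {N φ : (Fin n → ℂ) → ℂ}
    (hW : IsOpen W) (hN : ContinuousOn N W) (hNd : ∀ y ∈ W, N y ≠ 0 → DifferentiableAt ℂ N y)
    (hdense : ∀ y ∈ W, y ∈ closure {z | N z ≠ 0})
    (hφ : ∀ y ∈ W, N y ≠ 0 → AnalyticAt ℂ φ y)
    (hφb : ∀ y ∈ W, ∃ M, ∀ᶠ z in 𝓝 y, N z ≠ 0 → ‖φ z‖ ≤ M) {y₀ : Fin n → ℂ} (hy₀ : y₀ ∈ W) :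
    ∃ φ' : (Fin n → ℂ) → ℂ, AnalyticAt ℂ φ' y₀ ∧ ∀ᶠ y in 𝓝 y₀, N y ≠ 0 → φ' y = φ y := by
  obtain ⟨M, hM⟩ := hφb y₀ hy₀
  obtain ⟨ε, hε, hεb⟩ := Metric.eventually_nhds_iff_ball.1 (hM.and (hW.mem_nhds hy₀))
  obtain ⟨y₁, hy₁N, hy₁⟩ := Metric.mem_closure_iff.1 (hdense y₀ hy₀) (ε / 4) (by positivity)
  set e : Fin n → ℂ := (2 : ℂ) • (y₁ - y₀) with he
  have hey : y₀ + (1 / 2 : ℂ) • e = y₁ := by simp [he, smul_smul]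
  have hen : ‖e‖ < ε / 2 := by
    rw [he, norm_smul, ← dist_eq_norm, dist_comm]
    norm_num
    linarith
  have hmem : ∀ y ∈ ball y₀ (ε / 4), ∀ t ∈ closedBall (0 : ℂ) 1, y + t • e ∈ ball y₀ ε := by
    intro y hy t ht
    rw [mem_ball, dist_eq_norm] at hy ⊢
    have h1 : ‖t‖ ≤ 1 := by simpa using ht
    calc ‖y + t • e - y₀‖ = ‖(y - y₀) + t • e‖ := by congr 1; abel
      _ ≤ ‖y - y₀‖ + ‖t‖ * ‖e‖ := (norm_add_le _ _).trans (by rw [norm_smul])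
      _ < ε := by nlinarith [norm_nonneg e]
  have hlin : ∀ y : Fin n → ℂ, Continuous fun t : ℂ => y + t • e := fun y => by fun_prop
  have hlind : ∀ (y : Fin n → ℂ) (t : ℂ), DifferentiableAt ℂ (fun t : ℂ => y + t • e) t :=
    fun y t => by fun_prop
  have hsc : ∀ y ∈ ball y₀ (ε / 4), ContinuousOn (fun t : ℂ => N (y + t • e)) (closedBall 0 1) :=
    fun y hy => hN.comp (hlin y).continuousOn fun t ht => (hεb _ (hmem y hy t ht)).2
  have hsd : ∀ y ∈ ball y₀ (ε / 4), ∀ t ∈ ball (0 : ℂ) 1, N (y + t • e) ≠ 0 →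
      DifferentiableAt ℂ (fun t : ℂ => N (y + t • e)) t := fun y hy t ht hne =>
    (hNd _ (hεb _ (hmem y hy t (ball_subset_closedBall ht))).2 hne).comp (f := fun t : ℂ => y + t • e) t (hlind y t)
  have hy₀b : y₀ ∈ ball y₀ (ε / 4) := mem_ball_self (by positivity)
  obtain ⟨r, hr, hr1, hrN⟩ : ∃ r : ℝ, 0 < r ∧ r < 1 ∧
      ∀ t ∈ sphere (0 : ℂ) r, N (y₀ + t • e) ≠ 0 := by
    have hka : AnalyticOnNhd ℂ (fun t : ℂ => N (y₀ + t • e)) (ball 0 1) :=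
      (differentiableOn_ball_of_differentiableAt_off_zeros (hsc y₀ hy₀b) (hsd y₀ hy₀b)
        ).analyticOnNhd isOpen_ball
    have h0 : (0 : ℂ) ∈ ball (0 : ℂ) 1 := mem_ball_self one_pos
    rcases (hka 0 h0).eventually_eq_zero_or_eventually_ne_zero with h | h
    · have := hka.eqOn_zero_of_preconnected_of_eventuallyEq_zero
        (convex_ball 0 1).isPreconnected h0 h (show (1 / 2 : ℂ) ∈ ball (0 : ℂ) 1 by simp; norm_num)
      simp only [hey] at this
      exact absurd this hy₁N
    · rw [eventually_nhdsWithin_iff] at h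
      obtain ⟨a, ha, hab⟩ := Metric.eventually_nhds_iff_ball.1 h
      refine ⟨min a 1 / 2, by positivity, ?_, fun t ht => hab t ?_ ?_⟩
      · linarith [min_le_right a 1]
      · rw [mem_sphere_zero_iff_norm] at ht
        rw [mem_ball_zero_iff, ht]
        linarith [min_le_left a 1]
      · exact ne_of_mem_sphere ht (by positivity)
  have hsph : ∀ᶠ y in 𝓝 y₀, ∀ t ∈ sphere (0 : ℂ) r, N (y + t • e) ≠ 0 := by
    refine (isCompact_sphere (0 : ℂ) r).eventually_forall_of_forall_eventually fun t ht => ?_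
    have hc : ContinuousAt (fun p : (Fin n → ℂ) × ℂ => N (p.1 + p.2 • e)) (y₀, t) := by
      refine ContinuousAt.comp (g := N) (hN.continuousAt (hW.mem_nhds ?_)) (by fun_prop)
      refine (hεb _ (hmem y₀ hy₀b t ?_)).2
      exact sphere_subset_closedBall.trans (closedBall_subset_closedBall hr1.le) ht
    exact hc.eventually_ne (hrN t ht)
  obtain ⟨η, hη, hηb⟩ := Metric.nhds_basis_closedBall.eventually_iff.1
    (hsph.and (isOpen_ball.mem_nhds hy₀b))
  have hsc1 : sphere (0 : ℂ) r ⊆ closedBall 0 1 :=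
    sphere_subset_closedBall.trans (closedBall_subset_closedBall hr1.le)
  refine ⟨fun y => Real.circleAverage (fun t => φ (y + t • e)) 0 r, ?_, ?_⟩
  · refine (differentiableOn_circleAverage_add_smul (A := {y ∈ W | N y ≠ 0}) (η := η)
      (fun y hy => hφ y hy.1 hy.2) hr.le fun y hy t ht => ⟨?_, (hηb hy).1 t ht⟩
      ).analyticOnNhd_pi isOpen_ball y₀ (mem_ball_self hη)
    exact (hεb _ (hmem y (hηb hy).2 t (hsc1 ht))).2
  · filter_upwards [closedBall_mem_nhds y₀ hη] with y hy hNy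
    have hyb := (hηb hy).2
    refine (circleAverage_eq_of_bounded_off_zeros (k := fun t => N (y + t • e)) (M := M)
      (hsc y hyb) (hsd y hyb) ?_ ?_ (by simpa using hNy) hr hr1 (hηb hy).1).trans (by simp)
    · intro t ht hne
      exact (hφ _ (hεb _ (hmem y hyb t (ball_subset_closedBall ht))).2 hne).differentiableAt.comp
        (f := fun t : ℂ => y + t • e) t (hlind y t)
    · intro t ht hne
      exact (hεb _ (hmem y hyb t (ball_subset_closedBall ht))).1 hne

/-- **Riemann extension** across the zero set of a continuous function that is holomorphic off its
zeros. -/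
theorem exists_analyticOnNhd_eq_off_zeros {n : ℕ} {W : Set (Fin n → ℂ)} {N φ : (Fin n → ℂ) → ℂ}
    (hW : IsOpen W) (hN : ContinuousOn N W) (hNd : ∀ y ∈ W, N y ≠ 0 → DifferentiableAt ℂ N y)
    (hdense : ∀ y ∈ W, y ∈ closure {z | N z ≠ 0})
    (hφ : ∀ y ∈ W, N y ≠ 0 → AnalyticAt ℂ φ y)
    (hφb : ∀ y ∈ W, ∃ M, ∀ᶠ z in 𝓝 y, N z ≠ 0 → ‖φ z‖ ≤ M) :
    ∃ ψ : (Fin n → ℂ) → ℂ, AnalyticOnNhd ℂ ψ W ∧ ∀ y ∈ W, N y ≠ 0 → ψ y = φ y := by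
  have hloc : ∀ y₀ ∈ W, ∃ φ' : (Fin n → ℂ) → ℂ, AnalyticAt ℂ φ' y₀ ∧
      (∀ᶠ y in 𝓝 y₀, N y ≠ 0 → φ' y = φ y) ∧
      ∀ᶠ y in 𝓝 y₀, limUnder (𝓝[{z | N z ≠ 0}] y) φ = φ' y := by
    intro y₀ hy₀
    obtain ⟨φ', ha, he⟩ := exists_analyticAt_eq_off_zeros hW hN hNd hdense hφ hφb hy₀
    refine ⟨φ', ha, he, ?_⟩
    filter_upwards [ha.eventually_analyticAt, he.eventually_nhds, hW.mem_nhds hy₀] with y hya hye hyW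
    have : (𝓝[{z | N z ≠ 0}] y).NeBot := mem_closure_iff_nhdsWithin_neBot.1 (hdense y hyW)
    refine Tendsto.limUnder_eq ?_
    refine (hya.continuousAt.tendsto.mono_left nhdsWithin_le_nhds).congr' ?_
    rw [EventuallyEq, eventually_nhdsWithin_iff]
    exact hye
  refine ⟨fun y => limUnder (𝓝[{z | N z ≠ 0}] y) φ, fun y hy => ?_, fun y hy hne => ?_⟩
  · obtain ⟨φ', ha, -, he⟩ := hloc y hy
    exact ha.congr (EventuallyEq.symm he)
  · obtain ⟨φ', -, h1, h2⟩ := hloc y hy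
    exact h2.self_of_nhds.trans (h1.self_of_nhds hne)

/-- The complex Jacobian determinant. -/
abbrev jac {n : ℕ} (g : (Fin n → ℂ) → Fin n → ℂ) (x : Fin n → ℂ) : ℂ :=
  ContinuousLinearMap.det (fderiv ℂ g x)

theorem AnalyticOnNhd.jac {n : ℕ} {g : (Fin n → ℂ) → Fin n → ℂ} {U : Set (Fin n → ℂ)}
    (hg : AnalyticOnNhd ℂ g U) : AnalyticOnNhd ℂ (jac g) U := by
  intro x hx
  have h : _root_.jac g = fun x => ∑ τ : Equiv.Perm (Fin n), (Equiv.Perm.sign τ : ℂ) *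
      ∏ i, fderiv ℂ g x (Pi.single i 1) (τ i) := by
    ext x
    rw [_root_.jac, ContinuousLinearMap.det, ← LinearMap.det_toMatrix', Matrix.det_apply']
    simp [LinearMap.toMatrix'_apply]
  rw [h]
  refine Finset.analyticAt_fun_sum _ fun τ _ => analyticAt_const.mul ?_
  refine Finset.analyticAt_fun_prod _ fun i _ => ?_
  have h1 := ((ContinuousLinearMap.apply ℂ (Fin n → ℂ) (Pi.single i 1 : Fin n → ℂ)).analyticAt _).comp
    (hg.fderiv x hx)
  exact ((ContinuousLinearMap.proj (τ i) : (Fin n → ℂ) →L[ℂ] ℂ).analyticAt _).comp h1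

/-- The critical values of `g` on `U`. -/
abbrev branchLocus {n : ℕ} (g : (Fin n → ℂ) → Fin n → ℂ) (U : Set (Fin n → ℂ)) :
    Set (Fin n → ℂ) :=
  g '' {x ∈ U | jac g x = 0}

open MeasureTheory in
/-- Sard's theorem in equal dimensions. -/
theorem volume_branchLocus_eq_zero {n : ℕ} {g : (Fin n → ℂ) → Fin n → ℂ} {U : Set (Fin n → ℂ)}
    (hg : AnalyticOnNhd ℂ g U) : volume (branchLocus g U) = 0 := by
  refine addHaar_image_eq_zero_of_det_fderivWithin_eq_zero volume
    (f' := fun x => (fderiv ℂ g x).restrictScalars ℝ) (fun x hx => ?_) fun x hx => ?_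
  · exact ((hg x hx.1).differentiableAt.hasFDerivAt.restrictScalars ℝ).hasFDerivWithinAt
  · have h : LinearMap.det (fderiv ℂ g x : (Fin n → ℂ) →ₗ[ℂ] Fin n → ℂ) = 0 := hx.2
    have := LinearMap.det_restrictScalars (R := ℝ)
      (f := (fderiv ℂ g x : (Fin n → ℂ) →ₗ[ℂ] Fin n → ℂ))
    rw [h] at this
    rw [ContinuousLinearMap.det]
    refine Eq.trans ?_ (this.trans (by simp))
    rfl

theorem subset_closure_diff_branchLocus {n : ℕ} {g : (Fin n → ℂ) → Fin n → ℂ}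
    {U W : Set (Fin n → ℂ)} (hg : AnalyticOnNhd ℂ g U) (hW : IsOpen W) :
    W ⊆ closure (W \ branchLocus g U) := by
  intro y hy
  refine mem_closure_iff.2 fun o ho hyo => ?_
  by_contra hne
  have hsub : o ∩ W ⊆ branchLocus g U := by
    intro z hz
    by_contra h
    exact hne ⟨z, hz.1, hz.2, h⟩
  exact ((ho.inter hW).measure_pos MeasureTheory.volume ⟨y, hyo, hy⟩).ne'
    (MeasureTheory.measure_mono_null hsub (volume_branchLocus_eq_zero hg))

theorem HasStrictFDerivAt.of_jac_ne_zero {n : ℕ} {g : (Fin n → ℂ) → Fin n → ℂ} {p : Fin n → ℂ}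
    (hg : AnalyticAt ℂ g p) (hp : jac g p ≠ 0) : HasStrictFDerivAt g
      (((fderiv ℂ g p).toContinuousLinearEquivOfDetNeZero hp : (Fin n → ℂ) ≃L[ℂ] Fin n → ℂ) :
        (Fin n → ℂ) →L[ℂ] Fin n → ℂ) p := by
  simpa using hg.hasStrictFDerivAt

theorem exists_local_section {n : ℕ} {g : (Fin n → ℂ) → Fin n → ℂ} {p : Fin n → ℂ}
    (hg : AnalyticAt ℂ g p) (hp : jac g p ≠ 0) {O : Set (Fin n → ℂ)} (hO : IsOpen O)
    (hpO : p ∈ O) :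
    ∃ (A : Set (Fin n → ℂ)) (σ : (Fin n → ℂ) → Fin n → ℂ), IsOpen A ∧ p ∈ A ∧ A ⊆ O ∧
      AnalyticAt ℂ σ (g p) ∧ σ (g p) = p ∧
      ∀ᶠ y in 𝓝 (g p), σ y ∈ A ∧ g (σ y) = y ∧ ∀ x ∈ A, g x = y → x = σ y := by
  have hs := HasStrictFDerivAt.of_jac_ne_zero hg hp
  set φ := hs.toOpenPartialHomeomorph g with hφ
  have hφg : (φ : (Fin n → ℂ) → Fin n → ℂ) = g := hs.toOpenPartialHomeomorph_coe
  have hps : p ∈ φ.source := hs.mem_toOpenPartialHomeomorph_source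
  have hleft : ∀ x ∈ φ.source, φ.symm (g x) = x := fun x hx => by
    rw [← hφg]; exact φ.left_inv hx
  have hA : IsOpen (φ.source ∩ O) := φ.open_source.inter hO
  have han : AnalyticAt ℂ φ.symm (g p) := by
    have := φ.analyticAt_symm' hps (i := (fderiv ℂ g p).toContinuousLinearEquivOfDetNeZero hp)
      (by rwa [hφg]) (by rw [hφg]; simp)
    rwa [hφg] at this
  refine ⟨φ.source ∩ O, φ.symm, hA, ⟨hps, hpO⟩, inter_subset_right, han, hleft p hps, ?_⟩
  have h1 : ∀ᶠ y in 𝓝 (g p), y ∈ φ.target :=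
    φ.open_target.mem_nhds (hs.image_mem_toOpenPartialHomeomorph_target)
  have h2 : ∀ᶠ y in 𝓝 (g p), φ.symm y ∈ φ.source ∩ O :=
    han.continuousAt.eventually_mem (by rw [hleft p hps]; exact hA.mem_nhds ⟨hps, hpO⟩)
  filter_upwards [h1, h2] with y hy1 hy2
  refine ⟨hy2, ?_, fun x hx hxy => ?_⟩
  · have := φ.right_inv hy1
    rwa [hφg] at this
  · rw [← hxy, hleft x hx.1]

theorem exists_disjoint_local_sections {n : ℕ} {g : (Fin n → ℂ) → Fin n → ℂ}
    {y₀ : Fin n → ℂ} {S : Finset (Fin n → ℂ)} {O : Set (Fin n → ℂ)} (hO : IsOpen O)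
    (hS : ∀ p ∈ S, p ∈ O ∧ AnalyticAt ℂ g p ∧ jac g p ≠ 0 ∧ g p = y₀) :
    ∃ (A : (Fin n → ℂ) → Set (Fin n → ℂ)) (σ : (Fin n → ℂ) → (Fin n → ℂ) → Fin n → ℂ),
      (∀ p ∈ S, IsOpen (A p) ∧ p ∈ A p ∧ A p ⊆ O ∧ AnalyticAt ℂ (σ p) y₀ ∧ σ p y₀ = p) ∧
      ∀ᶠ y in 𝓝 y₀, (∀ p ∈ S, σ p y ∈ A p ∧ g (σ p y) = y ∧ ∀ x ∈ A p, g x = y → x = σ p y) ∧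
        InjOn (fun p => σ p y) S := by
  obtain ⟨B, hB, hdisj⟩ := S.finite_toSet.t2_separation
  have h : ∀ p, ∃ (A : Set (Fin n → ℂ)) (σ : (Fin n → ℂ) → Fin n → ℂ), p ∈ S →
      IsOpen A ∧ p ∈ A ∧ A ⊆ O ∩ B p ∧ AnalyticAt ℂ σ y₀ ∧ σ y₀ = p ∧
      ∀ᶠ y in 𝓝 y₀, σ y ∈ A ∧ g (σ y) = y ∧ ∀ x ∈ A, g x = y → x = σ y := by
    intro p
    by_cases hp : p ∈ S
    · obtain ⟨h1, h2, h3, rfl⟩ := hS p hp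
      obtain ⟨A, σ, h⟩ := exists_local_section h2 h3 (hO.inter (hB p).2) ⟨h1, (hB p).1⟩
      exact ⟨A, σ, fun _ => h⟩
    · exact ⟨∅, id, fun h => absurd h hp⟩
  choose A σ hAσ using h
  refine ⟨A, σ, fun p hp => ?_, ?_⟩
  · obtain ⟨h1, h2, h3, h4, h5, -⟩ := hAσ p hp
    exact ⟨h1, h2, h3.trans inter_subset_left, h4, h5⟩
  · have := (eventually_all_finset S).2 fun p hp => (hAσ p hp).2.2.2.2.2
    filter_upwards [this] with y hy
    refine ⟨hy, fun p hp q hq hpq => ?_⟩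
    by_contra hne
    have hpq' : σ p y = σ q y := hpq
    refine Set.disjoint_left.1 (hdisj hp hq hne) ((hAσ p hp).2.2.1 (hy p hp).1).2 ?_
    rw [hpq']
    exact ((hAσ q hq).2.2.1 (hy q hq).1).2

/-- A proper holomorphic map with finite fibers, `δ` points over each noncritical value. -/
structure IsBranchedCover {n : ℕ} (g : (Fin n → ℂ) → Fin n → ℂ) (U W : Set (Fin n → ℂ)) (δ : ℕ) :
    Prop where
  isOpen_source : IsOpen U
  isOpen_target : IsOpen W
  analytic : AnalyticOnNhd ℂ g U
  mapsTo : MapsTo g U W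
  finite_fiber : ∀ y, (U ∩ g ⁻¹' {y}).Finite
  isCompact_preimage : ∀ K ⊆ W, IsCompact K → IsCompact (U ∩ g ⁻¹' K)
  ncard_fiber : ∀ y ∈ W, y ∉ branchLocus g U → (U ∩ g ⁻¹' {y}).ncard = δ
  subset_closure_jac_ne_zero : U ⊆ closure {x | jac g x ≠ 0}

namespace IsBranchedCover

variable {n δ : ℕ} {g : (Fin n → ℂ) → Fin n → ℂ} {U W : Set (Fin n → ℂ)}

open Metric in
theorem eventually_fiber_subset (hg : IsBranchedCover g U W δ) {y₀ : Fin n → ℂ} (hy₀ : y₀ ∈ W)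
    {V : Set (Fin n → ℂ)} (hV : IsOpen V) (hfV : U ∩ g ⁻¹' {y₀} ⊆ V) :
    ∀ᶠ y in 𝓝 y₀, U ∩ g ⁻¹' {y} ⊆ V := by
  obtain ⟨ε, hε, hεW⟩ := Metric.nhds_basis_closedBall.mem_iff.1 (hg.isOpen_target.mem_nhds hy₀)
  have hK := (hg.isCompact_preimage _ hεW (isCompact_closedBall y₀ ε)).diff hV
  have hgK : IsCompact (g '' ((U ∩ g ⁻¹' closedBall y₀ ε) \ V)) :=
    hK.image_of_continuousOn (hg.analytic.continuousOn.mono fun x hx => hx.1.1)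
  have hy : y₀ ∉ g '' ((U ∩ g ⁻¹' closedBall y₀ ε) \ V) := by
    rintro ⟨x, hx, hxy⟩
    exact hx.2 (hfV ⟨hx.1.1, hxy⟩)
  filter_upwards [hgK.isClosed.isOpen_compl.mem_nhds hy, closedBall_mem_nhds y₀ hε] with y h1 h2
  rintro x ⟨hxU, rfl⟩
  by_contra hxV
  exact h1 ⟨x, ⟨⟨hxU, h2⟩, hxV⟩, rfl⟩

open Metric in
theorem eventually_norm_le_of_continuousOn (hg : IsBranchedCover g U W δ) {y₀ : Fin n → ℂ}
    (hy₀ : y₀ ∈ W) {h : (Fin n → ℂ) → ℂ} (hh : ContinuousOn h U) :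
    ∃ M, 1 ≤ M ∧ ∀ᶠ y in 𝓝 y₀, ∀ x ∈ U ∩ g ⁻¹' {y}, ‖h x‖ ≤ M := by
  obtain ⟨ε, hε, hεW⟩ := Metric.nhds_basis_closedBall.mem_iff.1 (hg.isOpen_target.mem_nhds hy₀)
  obtain ⟨C, hC⟩ := (hg.isCompact_preimage _ hεW (isCompact_closedBall y₀ ε)
    ).exists_bound_of_continuousOn (hh.mono inter_subset_left)
  refine ⟨max C 1, le_max_right _ _, ?_⟩
  filter_upwards [closedBall_mem_nhds y₀ hε] with y hy
  rintro x ⟨hxU, rfl⟩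
  exact (hC x ⟨hxU, hy⟩).trans (le_max_left _ _)

theorem jac_ne_zero (hy : y ∉ branchLocus g U) {x : Fin n → ℂ} (hx : x ∈ U ∩ g ⁻¹' {y}) :
    jac g x ≠ 0 :=
  fun h => hy ⟨x, ⟨hx.1, h⟩, hx.2⟩

theorem isOpen_jac_ne_zero (hg : IsBranchedCover g U W δ) : IsOpen {x ∈ U | jac g x ≠ 0} :=
  hg.analytic.jac.continuousOn.isOpen_inter_preimage hg.isOpen_source isOpen_compl_singleton

theorem eventually_notMem_branchLocus (hg : IsBranchedCover g U W δ) {y₀ : Fin n → ℂ}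
    (hy₀ : y₀ ∈ W) (hb : y₀ ∉ branchLocus g U) : ∀ᶠ y in 𝓝 y₀, y ∉ branchLocus g U := by
  filter_upwards [hg.eventually_fiber_subset hy₀ hg.isOpen_jac_ne_zero
    fun x hx => ⟨hx.1, jac_ne_zero hb hx⟩] with y hy
  rintro ⟨x, hx, hxy⟩
  exact (hy ⟨hx.1, hxy⟩).2 hx.2

/-- Near a noncritical value, the fibers are parametrized by finitely many holomorphic sections. -/
theorem exists_sections (hg : IsBranchedCover g U W δ) {y₀ : Fin n → ℂ} (hy₀ : y₀ ∈ W)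
    (hb : y₀ ∉ branchLocus g U) :
    ∃ (S : Finset (Fin n → ℂ)) (σ : (Fin n → ℂ) → (Fin n → ℂ) → Fin n → ℂ),
      (∀ p ∈ S, p ∈ U ∧ g p = y₀ ∧ AnalyticAt ℂ (σ p) y₀ ∧ σ p y₀ = p) ∧
      ∀ᶠ y in 𝓝 y₀, (∀ p ∈ S, g (σ p y) = y) ∧ InjOn (fun p => σ p y) S ∧
        U ∩ g ⁻¹' {y} = (fun p => σ p y) '' S := by
  set S := (hg.finite_fiber y₀).toFinset with hS
  have hmem : ∀ p, p ∈ S ↔ p ∈ U ∩ g ⁻¹' {y₀} := fun p => by simp [hS]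
  obtain ⟨A, σ, hA, hev⟩ := exists_disjoint_local_sections (S := S) (y₀ := y₀) hg.isOpen_source
    fun p hp => ⟨((hmem p).1 hp).1, hg.analytic p ((hmem p).1 hp).1,
      jac_ne_zero hb ((hmem p).1 hp), ((hmem p).1 hp).2⟩
  refine ⟨S, σ, fun p hp => ⟨((hmem p).1 hp).1, ((hmem p).1 hp).2, (hA p hp).2.2.2⟩, ?_⟩
  have hV := hg.eventually_fiber_subset hy₀ (V := ⋃ p ∈ S, A p)
    (isOpen_biUnion fun p hp => (hA p hp).1)
    fun p hp => mem_biUnion ((hmem p).2 hp) (hA p ((hmem p).2 hp)).2.1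
  filter_upwards [hev, hV] with y hy hyV
  refine ⟨fun p hp => (hy.1 p hp).2.1, hy.2, Subset.antisymm (fun x hx => ?_) ?_⟩
  · obtain ⟨p, hp, hxp⟩ := mem_iUnion₂.1 (hyV hx)
    exact ⟨p, hp, ((hy.1 p hp).2.2 x hxp hx.2).symm⟩
  · rintro _ ⟨p, hp, rfl⟩
    exact ⟨(hA p hp).2.2.1 (hy.1 p hp).1, (hy.1 p hp).2.1⟩

/-- Near a critical value `g q`, the fibers over noncritical values meet any neighborhood
of the critical points of the fiber over `g q`. -/
theorem eventually_exists_mem_fiber (hg : IsBranchedCover g U W δ) {y₀ : Fin n → ℂ} (hy₀ : y₀ ∈ W)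
    (hb : y₀ ∈ branchLocus g U) {O : Set (Fin n → ℂ)} (hO : IsOpen O)
    (hO' : ∀ x ∈ U ∩ g ⁻¹' {y₀}, jac g x = 0 → x ∈ O) :
    ∀ᶠ y in 𝓝 y₀, y ∉ branchLocus g U → ∃ x ∈ U ∩ g ⁻¹' {y}, x ∈ O := by
  classical
  obtain ⟨q, ⟨hqU, hqJ⟩, hqy⟩ := hb
  set S := (hg.finite_fiber y₀).toFinset.filter (fun p => jac g p ≠ 0) with hS
  have hmem : ∀ p, p ∈ S ↔ p ∈ U ∩ g ⁻¹' {y₀} ∧ jac g p ≠ 0 := fun p => by simp [hS]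
  have hqS : Disjoint (S : Set (Fin n → ℂ)) {q} :=
    Set.disjoint_singleton_right.2 fun h => ((hmem q).1 h).2 hqJ
  obtain ⟨u, v, hu, hv, hSu, hqv, huv⟩ :=
    SeparatedNhds.of_isCompact_isCompact S.finite_toSet.isCompact isCompact_singleton hqS
  obtain ⟨A, σ, hA, hev⟩ := exists_disjoint_local_sections (S := S) (y₀ := y₀)
    (hg.isOpen_source.inter hu) fun p hp => ⟨⟨((hmem p).1 hp).1.1, hSu hp⟩,
      hg.analytic p ((hmem p).1 hp).1.1, ((hmem p).1 hp).2, ((hmem p).1 hp).1.2⟩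
  have hV := hg.eventually_fiber_subset hy₀ (V := O ∪ ⋃ p ∈ S, A p)
    (hO.union (isOpen_biUnion fun p hp => (hA p hp).1)) (by
      intro p hp
      by_cases hpJ : jac g p = 0
      · exact Or.inl (hO' p hp hpJ)
      · have := (hmem p).2 ⟨hp, hpJ⟩
        exact Or.inr (mem_biUnion this (hA p this).2.1))
  have hev' := hev.and (hV.and (hg.isOpen_target.mem_nhds hy₀))
  obtain ⟨Y, hY, hYo, hyY⟩ := mem_nhds_iff.1 hev'
  have hlt : S.card + 1 ≤ δ := by
    have hgq : ∀ᶠ x in 𝓝 q, x ∈ v ∩ U ∧ g x ∈ Y := by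
      refine Eventually.and ((hv.inter hg.isOpen_source).mem_nhds ⟨hqv rfl, hqU⟩) ?_
      exact (hg.analytic q hqU).continuousAt.eventually_mem (by rw [hqy]; exact hYo.mem_nhds hyY)
    obtain ⟨x₁, hx₁J, hx₁⟩ := ((mem_closure_iff_frequently.1
      (hg.subset_closure_jac_ne_zero hqU)).and_eventually hgq.eventually_nhds).exists
    have hopen := (HasStrictFDerivAt.of_jac_ne_zero
      (hg.analytic x₁ hx₁.self_of_nhds.1.2) hx₁J).map_nhds_eq_of_equiv
    have himg : g '' {x | x ∈ v ∩ U ∧ g x ∈ Y} ∈ 𝓝 (g x₁) := by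
      rw [← hopen]; exact image_mem_map hx₁
    obtain ⟨o, hoi, hoo, hx₁o⟩ := mem_nhds_iff.1 himg
    obtain ⟨y₁, hy₁o, hy₁W, hy₁b⟩ := mem_closure_iff.1
      (subset_closure_diff_branchLocus hg.analytic hg.isOpen_target
        (hg.mapsTo hx₁.self_of_nhds.1.2)) o hoo hx₁o
    obtain ⟨x, ⟨⟨hxv, hxU⟩, hxY⟩, rfl⟩ := hoi hy₁o
    have hsec := (hY hxY).1
    rw [← hg.ncard_fiber _ hy₁W hy₁b]
    have hx : x ∉ S.image (fun p => σ p (g x)) := by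
      intro h
      obtain ⟨p, hp, hpx⟩ := Finset.mem_image.1 h
      refine Set.disjoint_left.1 huv (((hA p hp).2.2.1 (hsec.1 p hp).1).2) ?_
      rwa [hpx]
    rw [← Finset.card_image_of_injOn hsec.2, ← Finset.card_insert_of_notMem hx,
      ← Set.ncard_coe_finset]
    refine Set.ncard_le_ncard ?_ (hg.finite_fiber _)
    intro z hz
    rcases Finset.mem_insert.1 (Finset.mem_coe.1 hz) with rfl | hz
    · exact ⟨hxU, rfl⟩
    · obtain ⟨p, hp, rfl⟩ := Finset.mem_image.1 hz
      exact ⟨((hA p hp).2.2.1 (hsec.1 p hp).1).1, (hsec.1 p hp).2.1⟩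
  filter_upwards [hev'] with y hy hyb
  by_contra! hne
  have hle : (U ∩ g ⁻¹' {y}).ncard ≤ S.card := by
    refine (Set.ncard_le_ncard (t := (S.image fun p => σ p y : Finset _)) ?_
      (Finset.finite_toSet _)).trans ?_
    · intro x hx
      rcases hy.2.1 hx with h | h
      · exact absurd h (hne x hx)
      · obtain ⟨p, hp, hxp⟩ := mem_iUnion₂.1 h
        exact Finset.mem_coe.2 (Finset.mem_image.2 ⟨p, hp, ((hy.1.1 p hp).2.2 x hxp hx.2).symm⟩)
    · rw [Set.ncard_coe_finset]; exact Finset.card_image_le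
  rw [hg.ncard_fiber y hy.2.2 hyb] at hle
  omega



/-- The product of the Jacobian determinant over the fibers. -/
def normJac (g : (Fin n → ℂ) → Fin n → ℂ) (U : Set (Fin n → ℂ)) (y : Fin n → ℂ) : ℂ :=
  ∏ᶠ x ∈ U ∩ g ⁻¹' {y}, jac g x

theorem normJac_ne_zero_iff (hg : IsBranchedCover g U W δ) (y : Fin n → ℂ) :
    normJac g U y ≠ 0 ↔ y ∉ branchLocus g U := by
  rw [normJac, finprod_mem_eq_finite_toFinset_prod _ (hg.finite_fiber y), Finset.prod_ne_zero_iff]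
  constructor
  · rintro h ⟨x, hx, hxy⟩
    exact h x (by simpa using ⟨hx.1, hxy⟩) hx.2
  · intro h x hx
    exact jac_ne_zero h (by simpa using hx)

theorem analyticAt_normJac (hg : IsBranchedCover g U W δ) {y₀ : Fin n → ℂ} (hy₀ : y₀ ∈ W)
    (hb : y₀ ∉ branchLocus g U) : AnalyticAt ℂ (normJac g U) y₀ := by
  obtain ⟨S, σ, hS, hev⟩ := hg.exists_sections hy₀ hb
  have : AnalyticAt ℂ (fun y => ∏ p ∈ S, jac g (σ p y)) y₀ := by
    refine Finset.analyticAt_fun_prod _ fun p hp => ?_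
    obtain ⟨h1, -, h2, h3⟩ := hS p hp
    exact AnalyticAt.comp (g := jac g) (by rw [h3]; exact hg.analytic.jac p h1) h2
  refine this.congr ?_
  filter_upwards [hev] with y hy
  rw [normJac, hy.2.2, finprod_mem_image hy.2.1, finprod_mem_coe_finset]

theorem norm_normJac_le (hg : IsBranchedCover g U W δ) {y : Fin n → ℂ} (hy : y ∈ W)
    (hb : y ∉ branchLocus g U) {M ε : ℝ} (hM : 1 ≤ M)
    (hMb : ∀ x ∈ U ∩ g ⁻¹' {y}, ‖jac g x‖ ≤ M) {x : Fin n → ℂ} (hx : x ∈ U ∩ g ⁻¹' {y})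
    (hxε : ‖jac g x‖ ≤ ε) : ‖normJac g U y‖ ≤ ε * M ^ δ := by
  classical
  have hx' : x ∈ (hg.finite_fiber y).toFinset := by simpa using hx
  rw [normJac, finprod_mem_eq_finite_toFinset_prod _ (hg.finite_fiber y),
    ← Finset.mul_prod_erase _ _ hx', norm_mul, norm_prod]
  have hcard : ((hg.finite_fiber y).toFinset.erase x).card ≤ δ := by
    refine Finset.card_erase_le.trans ?_
    rw [← Set.ncard_eq_toFinset_card _ (hg.finite_fiber y), hg.ncard_fiber y hy hb]
  refine mul_le_mul hxε ?_ (by positivity) ((norm_nonneg _).trans hxε)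
  refine (Finset.prod_le_prod (g := fun _ => M) (fun _ _ => norm_nonneg _) fun z hz =>
    hMb z ?_).trans (by rw [Finset.prod_const]; exact pow_le_pow_right₀ hM hcard)
  simpa using Finset.mem_of_mem_erase hz

theorem continuousOn_normJac (hg : IsBranchedCover g U W δ) : ContinuousOn (normJac g U) W := by
  intro y₀ hy₀
  refine ContinuousAt.continuousWithinAt ?_
  by_cases hb : y₀ ∈ branchLocus g U
  swap
  · exact (hg.analyticAt_normJac hy₀ hb).continuousAt
  have h0 : normJac g U y₀ = 0 := by
    by_contra h
    exact (hg.normJac_ne_zero_iff y₀).1 h hb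
  obtain ⟨M, hM, hMb⟩ := hg.eventually_norm_le_of_continuousOn hy₀ hg.analytic.jac.continuousOn
  rw [ContinuousAt, h0, Metric.tendsto_nhds]
  intro η hη
  have hMδ : 0 < M ^ δ := by positivity
  set ε := η / (2 * M ^ δ) with hε
  have hε0 : 0 < ε := by positivity
  have hO : IsOpen (U ∩ {x | ‖jac g x‖ < ε}) :=
    hg.analytic.jac.continuousOn.norm.isOpen_inter_preimage hg.isOpen_source isOpen_Iio
  filter_upwards [hMb, hg.isOpen_target.mem_nhds hy₀,
    hg.eventually_exists_mem_fiber hy₀ hb hO fun x hx hJ => ⟨hx.1, by simpa [hJ] using hε0⟩]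
    with y hyM hyW hyO
  rw [dist_zero_right]
  by_cases hyb : y ∈ branchLocus g U
  · have : normJac g U y = 0 := by
      by_contra h
      exact (hg.normJac_ne_zero_iff y).1 h hyb
    simpa [this] using hη
  · obtain ⟨x, hx, hxO⟩ := hyO hyb
    refine (hg.norm_normJac_le hyW hyb hM hyM hx (le_of_lt hxO.2)).trans_lt ?_
    rw [hε]
    field_simp
    linarith

/-- The trace of a holomorphic function extends holomorphically across the critical values. -/
theorem exists_analyticOnNhd_trace (hg : IsBranchedCover g U W δ) {φ : (Fin n → ℂ) → ℂ}
    (hφ : AnalyticOnNhd ℂ φ U) :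
    ∃ ψ : (Fin n → ℂ) → ℂ, AnalyticOnNhd ℂ ψ W ∧
      ∀ y ∈ W, y ∉ branchLocus g U → ψ y = ∑ᶠ x ∈ U ∩ g ⁻¹' {y}, φ x := by
  suffices h : ∃ ψ : (Fin n → ℂ) → ℂ, AnalyticOnNhd ℂ ψ W ∧
      ∀ y ∈ W, normJac g U y ≠ 0 → ψ y = ∑ᶠ x ∈ U ∩ g ⁻¹' {y}, φ x by
    obtain ⟨ψ, h1, h2⟩ := h
    exact ⟨ψ, h1, fun y hy hb => h2 y hy ((hg.normJac_ne_zero_iff y).2 hb)⟩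
  refine exists_analyticOnNhd_eq_off_zeros hg.isOpen_target hg.continuousOn_normJac ?_ ?_ ?_ ?_
  · intro y hy hN
    exact (hg.analyticAt_normJac hy ((hg.normJac_ne_zero_iff y).1 hN)).differentiableAt
  · intro y hy
    refine closure_mono (fun z hz => ?_)
      (subset_closure_diff_branchLocus hg.analytic hg.isOpen_target hy)
    exact (hg.normJac_ne_zero_iff z).2 hz.2
  · intro y₀ hy₀ hN
    obtain ⟨S, σ, hS, hev⟩ := hg.exists_sections hy₀ ((hg.normJac_ne_zero_iff y₀).1 hN)
    have : AnalyticAt ℂ (fun y => ∑ p ∈ S, φ (σ p y)) y₀ := by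
      refine Finset.analyticAt_fun_sum _ fun p hp => ?_
      obtain ⟨h1, -, h2, h3⟩ := hS p hp
      exact AnalyticAt.comp (g := φ) (by rw [h3]; exact hφ p h1) h2
    refine this.congr ?_
    filter_upwards [hev] with y hy
    rw [hy.2.2, finsum_mem_image hy.2.1, finsum_mem_coe_finset]
  · intro y₀ hy₀
    obtain ⟨M, hM, hMb⟩ := hg.eventually_norm_le_of_continuousOn hy₀ hφ.continuousOn
    refine ⟨δ * M, ?_⟩
    filter_upwards [hMb, hg.isOpen_target.mem_nhds hy₀] with y hyM hyW hN
    rw [finsum_mem_eq_finite_toFinset_sum _ (hg.finite_fiber y)]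
    refine (norm_sum_le_of_le _ (f := φ) (n := fun _ => M) fun x hx =>
      hyM x (by simpa using hx)).trans ?_
    rw [Finset.sum_const, nsmul_eq_mul, ← Set.ncard_eq_toFinset_card _ (hg.finite_fiber y),
      hg.ncard_fiber y hyW ((hg.normJac_ne_zero_iff y).1 hN)]

theorem fderiv_trace_wedge_eq_zero (hg : IsBranchedCover g U W δ)
    {ω : (Fin n → ℂ) → ((Fin n → ℂ) →L[ℂ] ℂ)} {f φ ψ : (Fin n → ℂ) → ℂ}
    (hφ : AnalyticOnNhd ℂ φ U)
    (hpull : ∀ x ∈ U, (ω (g x)).comp (fderiv ℂ g x) = f x • fderiv ℂ φ x)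
    {y₀ : Fin n → ℂ} (hy₀ : y₀ ∈ W) (hb : y₀ ∉ branchLocus g U)
    (hψ : ∀ᶠ y in 𝓝 y₀, ψ y = ∑ᶠ x ∈ U ∩ g ⁻¹' {y}, φ x) (u v : Fin n → ℂ) :
    fderiv ℂ ψ y₀ u * ω y₀ v = fderiv ℂ ψ y₀ v * ω y₀ u := by
  obtain ⟨S, σ, hS, hev⟩ := hg.exists_sections hy₀ hb
  have heq : ψ =ᶠ[𝓝 y₀] fun y => ∑ p ∈ S, φ (σ p y) := by
    filter_upwards [hev, hψ] with y hy hψy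
    rw [hψy, hy.2.2, finsum_mem_image hy.2.1, finsum_mem_coe_finset]
  have hd : HasFDerivAt ψ (∑ p ∈ S, (fderiv ℂ φ p).comp (fderiv ℂ (σ p) y₀)) y₀ := by
    refine HasFDerivAt.congr_of_eventuallyEq ?_ heq
    refine HasFDerivAt.fun_sum fun p hp => ?_
    obtain ⟨h1, -, h2, h3⟩ := hS p hp
    refine HasFDerivAt.comp (g := φ) y₀ ?_ h2.differentiableAt.hasFDerivAt
    rw [h3]
    exact (hφ p h1).differentiableAt.hasFDerivAt
  have hω : ∀ p ∈ S, ∀ w, ω y₀ w = f p * fderiv ℂ φ p (fderiv ℂ (σ p) y₀ w) := by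
    intro p hp w
    obtain ⟨h1, h4, h2, h3⟩ := hS p hp
    have hid : HasFDerivAt (fun y => g (σ p y)) ((fderiv ℂ g p).comp (fderiv ℂ (σ p) y₀)) y₀ := by
      refine HasFDerivAt.comp (g := g) y₀ ?_ h2.differentiableAt.hasFDerivAt
      rw [h3]
      exact (hg.analytic p h1).differentiableAt.hasFDerivAt
    have hid' : HasFDerivAt (fun y => g (σ p y)) (ContinuousLinearMap.id ℂ (Fin n → ℂ)) y₀ := by
      refine (hasFDerivAt_id y₀).congr_of_eventuallyEq ?_
      filter_upwards [hev] with y hy using hy.1 p hp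
    have h5 := DFunLike.congr_fun (hid.unique hid') w
    have h6 := DFunLike.congr_fun (hpull p h1) (fderiv ℂ (σ p) y₀ w)
    simp only [ContinuousLinearMap.comp_apply, ContinuousLinearMap.id_apply] at h5 h6
    rw [h5, h4] at h6
    simpa using h6
  rw [hd.fderiv]
  simp only [_root_.sum_apply, ContinuousLinearMap.comp_apply, Finset.sum_mul]
  refine Finset.sum_congr rfl fun p hp => ?_
  rw [hω p hp u, hω p hp v]
  ring

end IsBranchedCover

/-- Let `U, W` be connected open subsets of `ℂⁿ` and let `g : U → W` be a proper finite
surjective holomorphic map of topological degree `δ` with `g⁻¹(0) = {0}`.  Let `F` be a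
singular codimension one holomorphic foliation on `W` defined by the one-form `ω`, and
suppose the pullback foliation `g*F` is defined on `U` by `dx₁` (i.e. `g*ω = f • dx₁`
for a holomorphic `f ≢ 0`).  Then the pushforward (trace) function
`ψ y = Σ_{x ∈ g⁻¹(y)} x₁` (with multiplicities; off the critical values it is the
plain sum over the fiber) is a holomorphic function on `W` satisfying `dψ ∧ ω = 0`
on `W`. -/
theorem trace_of_first_integral_is_first_integral
    {n : ℕ} (hn : 0 < n) (g : Cn n → Cn n) (U W : Set (Cn n))
    (hUconn : IsConnected U) (hWconn : IsConnected W)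
    (hUopen : IsOpen U) (hWopen : IsOpen W)
    (hU0 : (0 : Cn n) ∈ U) (hW0 : (0 : Cn n) ∈ W)
    (hghol : AnalyticOnNhd ℂ g U) (hmaps : MapsTo g U W) (hg0 : g 0 = 0)
    (hsurj : g '' U = W)
    (hfib : ∀ y : Cn n, (U ∩ g ⁻¹' {y}).Finite)
    (hproper : ∀ K : Set (Cn n), K ⊆ W → IsCompact K → IsCompact (U ∩ g ⁻¹' K))
    (hfin0 : U ∩ g ⁻¹' {0} = {0})
    (δ : ℕ)
    (hdeg : ∀ y ∈ W, y ∉ g '' {x ∈ U | ContinuousLinearMap.det (fderiv ℂ g x) = 0} →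
      (U ∩ g ⁻¹' {y}).ncard = δ)
    (ω : OneForm n) (hF : IsFoliationOn ω W)
    (f : Cn n → ℂ) (hf : AnalyticOnNhd ℂ f U) (hfne : ∃ x ∈ U, f x ≠ 0)
    (hpull : ∀ x ∈ U, (ω (g x)).comp (fderiv ℂ g x)
      = f x • (ContinuousLinearMap.proj (⟨0, hn⟩ : Fin n) : Cn n →L[ℂ] ℂ)) :
    ∃ ψ : Cn n → ℂ, AnalyticOnNhd ℂ ψ W ∧
      (∀ y ∈ W, y ∉ g '' {x ∈ U | ContinuousLinearMap.det (fderiv ℂ g x) = 0} →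
        ψ y = ∑ᶠ x ∈ U ∩ g ⁻¹' {y}, x ⟨0, hn⟩) ∧
      (∀ y ∈ W, ∀ u v : Cn n, fderiv ℂ ψ y u * ω y v = fderiv ℂ ψ y v * ω y u) := by
  by_cases hJ : ∃ x ∈ U, jac g x ≠ 0
  · obtain ⟨x₀, hx₀, hx₀J⟩ := hJ
    have hg : IsBranchedCover g U W δ :=
      { isOpen_source := hUopen
        isOpen_target := hWopen
        analytic := hghol
        mapsTo := hmaps
        finite_fiber := hfib
        isCompact_preimage := hproper
        ncard_fiber := hdeg
        subset_closure_jac_ne_zero := fun x hx => by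
          rw [mem_closure_iff_frequently]
          by_contra h
          refine hx₀J (hghol.jac.eqOn_zero_of_preconnected_of_eventuallyEq_zero
            hUconn.isPreconnected hx ?_ hx₀)
          simpa [Filter.EventuallyEq] using h }
    have hφ : AnalyticOnNhd ℂ (fun x : Cn n => x ⟨0, hn⟩) U := fun x _ =>
      (ContinuousLinearMap.proj (⟨0, hn⟩ : Fin n) : Cn n →L[ℂ] ℂ).analyticAt x
    obtain ⟨ψ, hψ, hψeq⟩ := hg.exists_analyticOnNhd_trace hφ
    refine ⟨ψ, hψ, hψeq, fun y hy u v => ?_⟩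
    have hpull' : ∀ x ∈ U, (ω (g x)).comp (fderiv ℂ g x)
        = f x • fderiv ℂ (fun x : Cn n => x ⟨0, hn⟩) x := fun x hx => by
      rw [hpull x hx]
      congr 1
      exact ((ContinuousLinearMap.proj (⟨0, hn⟩ : Fin n) : Cn n →L[ℂ] ℂ).fderiv (x := x)).symm
    have hev : ∀ w : Cn n, ContinuousOn (fun y => fderiv ℂ ψ y w) W ∧
        ContinuousOn (fun y => ω y w) W := fun w =>
      ⟨hψ.fderiv.continuousOn.clm_apply continuousOn_const,
        hF.holo.continuousOn.clm_apply continuousOn_const⟩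
    have heq : EqOn (fun y => fderiv ℂ ψ y u * ω y v) (fun y => fderiv ℂ ψ y v * ω y u)
        (W \ branchLocus g U) := by
      intro z hz
      refine hg.fderiv_trace_wedge_eq_zero hφ hpull' hz.1 hz.2 ?_ u v
      filter_upwards [hWopen.mem_nhds hz.1, hg.eventually_notMem_branchLocus hz.1 hz.2]
        with w hw hwb using hψeq w hw hwb
    exact heq.of_subset_closure ((hev u).1.mul (hev v).2) ((hev v).1.mul (hev u).2) sdiff_subset
      (subset_closure_diff_branchLocus hghol hWopen) hy
  · push Not at hJ
    refine ⟨fun _ => 0, fun _ _ => analyticAt_const, fun y hy hyb => ?_, fun y _ u v => by simp⟩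
    rw [← hsurj] at hy
    obtain ⟨x, hx, rfl⟩ := hy
    exact absurd ⟨x, ⟨hx, hJ x hx⟩, rfl⟩ hyb
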